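/- Let P range over a finite index set and for each P let m_P⁽¹⁾, m_P⁽²⁾ ≥ 0 and k_P ≥ 1 be integers, not all m_P⁽ⁱ⁾ zero. Then, in the dominance order, the concatenation over i = 1, 2 of the partitions ∑_P (2m_P⁽ⁱ⁾k_P, 2(m_P⁽ⁱ⁾−1)k_P, …, 4k_P, 2k_P) (iterated sum of partitions over P) is ≤ the transpose of the partition ⊔_P ( [m_P⁽¹⁾+m_P⁽²⁾]^{2k_P} ⊔ [|m_P⁽¹⁾−m_P⁽²⁾|−1]^{2k_P} ). -/

import Mathlib

/-- A partition: a finite multiset of positive integers. -/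
def IsPartition (p : Multiset ℕ) : Prop := ∀ x ∈ p, 0 < x

/-- The parts of `p` in weakly decreasing order. -/
def descList (p : Multiset ℕ) : List ℕ := (p.sort (· ≤ ·)).reverse

/-- The sum of the `j` largest parts of `p` (padding with trailing zeros). -/
def topSum (p : Multiset ℕ) (j : ℕ) : ℕ := ((descList p).take j).sum

/-- Dominance order: `DomLE α β` means `α ≤ β`, i.e. each partial sum of the
largest parts of `α` is at most the corresponding partial sum for `β`. -/
def DomLE (α β : Multiset ℕ) : Prop := ∀ j : ℕ, topSum α j ≤ topSum β j

/-- Transpose of a partition: the `j`-th part is the number of parts `≥ j`. -/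
def transposeP (p : Multiset ℕ) : Multiset ℕ :=
  ((Multiset.range p.sum).map fun j => (p.filter fun x => j + 1 ≤ x).card).filter
    fun c => c ≠ 0

/-- The weakly decreasing list of parts padded with zeros to length `n`. -/
def padDesc (p : Multiset ℕ) (n : ℕ) : List ℕ :=
  descList p ++ List.replicate (n - Multiset.card p) 0

/-- The sum of two partitions: add the parts pointwise after sorting in
weakly decreasing order and padding with trailing zeros. -/
def sumParts (p q : Multiset ℕ) : Multiset ℕ :=
  (↑(List.zipWith (· + ·)
      (padDesc p (max (Multiset.card p) (Multiset.card q)))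
      (padDesc q (max (Multiset.card p) (Multiset.card q)))) : Multiset ℕ).filter
    fun x => x ≠ 0

/-- The string `[a] = (a, a-2, a-4, …, 2 or 1)`, empty for `a = 0`. -/
def strP (a : ℕ) : Multiset ℕ := (Multiset.range ((a + 1) / 2)).map fun k => a - 2 * k

/-- The partition `(a, a-1, …, 2, 1)`. -/
def downP (a : ℕ) : Multiset ℕ := (Multiset.range a).map fun k => a - k

/-- The partition `(2a-1, 2a-3, …, 3, 1)`. -/
def oddsDown (a : ℕ) : Multiset ℕ := (Multiset.range a).map fun k => 2 * (a - k) - 1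

/-- The partition `(2a, 2a-2, …, 4, 2)`. -/
def evensDown (a : ℕ) : Multiset ℕ := (Multiset.range a).map fun k => 2 * (a - k)

/-- `p⁻`: decrease the smallest part of `p` by 1 (deleting it if it was 1). -/
def pMinus (p : Multiset ℕ) : Multiset ℕ :=
  match p.sort (· ≤ ·) with
  | [] => 0
  | a :: rest => (↑rest : Multiset ℕ) + (if a ≤ 1 then 0 else {a - 1})

/-- A partition is symplectic if every odd part occurs with even multiplicity. -/
def IsSymplectic (p : Multiset ℕ) : Prop := ∀ x : ℕ, Odd x → Even (p.count x)

/-- A partition is orthogonal if every even part occurs with even multiplicity. -/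
def IsOrthogonal (p : Multiset ℕ) : Prop := ∀ x : ℕ, Even x → Even (p.count x)

/-- `IsCCollapse p q`: `q` is the C-collapse `p_C` of `p`, i.e. the unique maximal
symplectic partition of the same total that is `≤ p` in the dominance order. -/
def IsCCollapse (p q : Multiset ℕ) : Prop :=
  IsPartition q ∧ IsSymplectic q ∧ q.sum = p.sum ∧ DomLE q p ∧
    ∀ r : Multiset ℕ, IsPartition r → IsSymplectic r → r.sum = p.sum → DomLE r p → DomLE r q


section TopSum

theorem coe_descList (p : Multiset ℕ) : (↑(descList p) : Multiset ℕ) = p := by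
  rw [descList, Multiset.coe_reverse, Multiset.sort_eq]

theorem pairwise_descList (p : Multiset ℕ) : (descList p).Pairwise (· ≥ ·) := by
  rw [descList, List.pairwise_reverse]
  exact Multiset.pairwise_sort p (· ≤ ·)

theorem sum_take_le_sum_take_cons {a : ℕ} {l : List ℕ} (h : (a :: l).Pairwise (· ≥ ·)) (j : ℕ) :
    (l.take j).sum ≤ ((a :: l).take j).sum := by
  induction l generalizing a j with
  | nil => simp
  | cons b l ih =>
    cases j with
    | zero => simp
    | succ j =>
      have hb := ih (List.pairwise_cons.1 h).2 j
      have hab : b ≤ a := (List.pairwise_cons.1 h).1 b (by simp)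
      simp only [List.take_succ_cons, List.sum_cons] at hb ⊢
      omega

theorem List.Sublist.sum_le_sum_take {l' l : List ℕ} (hl : l'.Sublist l)
    (h : l.Pairwise (· ≥ ·)) {j : ℕ} (hj : l'.length ≤ j) : l'.sum ≤ (l.take j).sum := by
  induction hl generalizing j with
  | slnil => simp
  | cons a hs ih =>
    exact (ih (List.pairwise_cons.1 h).2 hj).trans (sum_take_le_sum_take_cons h j)
  | cons_cons a hs ih =>
    cases j with
    | zero => simp at hj
    | succ j =>
      have := ih (List.pairwise_cons.1 h).2 (j := j) (by simpa using hj)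
      simpa using this

theorem sum_le_topSum {s p : Multiset ℕ} (h : s ≤ p) {j : ℕ} (hj : s.card ≤ j) :
    s.sum ≤ topSum p j := by
  rw [← coe_descList p] at h
  induction s using Quotient.inductionOn with
  | h l =>
    obtain ⟨l', hperm, hsub⟩ := Multiset.coe_le.1 h
    have := hsub.sum_le_sum_take (pairwise_descList p) (j := j)
      (by simpa [hperm.length_eq] using hj)
    simpa [← hperm.sum_eq, topSum] using this

theorem exists_sum_eq_topSum (p : Multiset ℕ) (j : ℕ) :
    ∃ s ≤ p, s.card ≤ j ∧ s.sum = topSum p j := by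
  refine ⟨((descList p).take j : List ℕ), ?_, ?_, ?_⟩
  · conv_rhs => rw [← coe_descList p]
    exact (List.take_sublist _ _).subperm
  · simp
  · simp [topSum]

theorem exists_topSum_add_le (p q : Multiset ℕ) (j : ℕ) :
    ∃ a b, a + b ≤ j ∧ topSum (p + q) j ≤ topSum p a + topSum q b := by
  obtain ⟨s, hs, hc, hsum⟩ := exists_sum_eq_topSum (p + q) j
  have hsplit : s ∩ p + (s - p) = s := by
    rw [add_comm, Multiset.sub_add_inter]
  refine ⟨(s ∩ p).card, (s - p).card, ?_, ?_⟩
  · rw [← Multiset.card_add, hsplit]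
    exact hc
  · rw [← hsum, ← hsplit, Multiset.sum_add]
    simp only [hsplit]
    exact add_le_add (sum_le_topSum Multiset.inter_le_right le_rfl)
      (sum_le_topSum (by rw [tsub_le_iff_left]; exact hs) le_rfl)

theorem sum_le_topSum_of_le_add_replicate_zero {s p : Multiset ℕ} {r j : ℕ}
    (h : s ≤ p + Multiset.replicate r 0) (hj : s.card ≤ j) : s.sum ≤ topSum p j := by
  have hsplit : s ∩ p + (s - p) = s := by
    rw [add_comm, Multiset.sub_add_inter]
  have hzero : (s - p).sum = 0 := by
    refine Multiset.sum_eq_zero fun x hx => ?_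
    exact Multiset.eq_of_mem_replicate
      (Multiset.mem_of_le (tsub_le_iff_left.2 h) hx)
  rw [← hsplit, Multiset.sum_add, hzero, add_zero]
  exact sum_le_topSum Multiset.inter_le_right
    ((Multiset.card_le_card Multiset.inter_le_left).trans hj)

theorem List.Sublist.exists_sum_le_of_zipWith_add {l xs ys : List ℕ}
    (h : l.Sublist (List.zipWith (· + ·) xs ys)) :
    ∃ xs' ys' : List ℕ, xs'.Sublist xs ∧ ys'.Sublist ys ∧ xs'.length = l.length ∧
      ys'.length = l.length ∧ l.sum = xs'.sum + ys'.sum := by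
  induction xs generalizing l ys with
  | nil => exact ⟨[], [], by simp_all⟩
  | cons x xs ih =>
    cases ys with
    | nil => exact ⟨[], [], by simp_all⟩
    | cons y ys =>
      rw [List.zipWith_cons_cons] at h
      cases h with
      | cons _ h =>
        obtain ⟨xs', ys', hx, hy, hr⟩ := ih h
        exact ⟨xs', ys', hx.cons x, hy.cons y, hr⟩
      | cons_cons _ h =>
        obtain ⟨xs', ys', hx, hy, hxl, hyl, hr⟩ := ih h
        refine ⟨x :: xs', y :: ys', hx.cons_cons x, hy.cons_cons y, ?_, ?_, ?_⟩
        · simp [hxl]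
        · simp [hyl]
        · simp only [List.sum_cons, hr]
          omega

theorem coe_padDesc (p : Multiset ℕ) (n : ℕ) :
    (↑(padDesc p n) : Multiset ℕ) = p + Multiset.replicate (n - p.card) 0 := by
  rw [padDesc, ← Multiset.coe_add, coe_descList, Multiset.coe_replicate]

theorem topSum_sumParts_le (p q : Multiset ℕ) (j : ℕ) :
    topSum (sumParts p q) j ≤ topSum p j + topSum q j := by
  obtain ⟨s, hs, hc, hsum⟩ := exists_sum_eq_topSum (sumParts p q) j
  rw [← hsum]
  replace hs := hs.trans (Multiset.filter_le _ _)
  induction s using Quotient.inductionOn with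
  | h l =>
    obtain ⟨l', hperm, hsub⟩ := Multiset.coe_le.1 hs
    obtain ⟨xs, ys, hx, hy, hxl, hyl, hl⟩ := hsub.exists_sum_le_of_zipWith_add
    have hlen : l'.length ≤ j := by simpa [hperm.length_eq] using hc
    have hxle : (↑xs : Multiset ℕ) ≤ ↑(padDesc p (max p.card q.card)) := hx.subperm
    have hyle : (↑ys : Multiset ℕ) ≤ ↑(padDesc q (max p.card q.card)) := hy.subperm
    rw [coe_padDesc] at hxle hyle
    have h1 := sum_le_topSum_of_le_add_replicate_zero hxle (j := j) (by simp [hxl, hlen])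
    have h2 := sum_le_topSum_of_le_add_replicate_zero hyle (j := j) (by simp [hyl, hlen])
    have h3 : l.sum = l'.sum := hperm.sum_eq.symm
    simp only [Multiset.sum_coe, Multiset.quot_mk_to_coe] at h1 h2 ⊢
    omega

theorem topSum_foldr_sumParts_le {ι : Type*} (f : ι → Multiset ℕ) (l : List ι) (j : ℕ) :
    topSum (l.foldr (fun i acc => sumParts (f i) acc) 0) j ≤
      (l.map fun i => topSum (f i) j).sum := by
  induction l with
  | nil => simp [topSum, descList]
  | cons i l ih =>
    simp only [List.foldr_cons, List.map_cons, List.sum_cons]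
    exact (topSum_sumParts_le _ _ _).trans (Nat.add_le_add_left ih _)

theorem topSum_eq_of_pairwise {l : List ℕ} (h : l.Pairwise (· ≥ ·)) (j : ℕ) :
    topSum ↑l j = (l.take j).sum := by
  have : descList ↑l = l :=
    List.Perm.eq_of_pairwise' (r := (· ≥ ·)) (pairwise_descList _) h
      (Multiset.coe_eq_coe.1 (coe_descList _))
  rw [topSum, this]

theorem topSum_map_mul_downP_le (c m j : ℕ) :
    topSum ((downP m).map fun x => c * x) j ≤ c * ∑ i ∈ Finset.range j, (m - i) := by
  have hcoe : (downP m).map (fun x => c * x) =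
      ↑((List.range m).map fun i => c * (m - i)) := by
    simp [downP, Multiset.range, Function.comp_def]
  rw [hcoe, topSum_eq_of_pairwise, ← List.map_take, List.take_range, Finset.mul_sum]
  · exact Finset.sum_le_sum_of_subset (f := fun i => c * (m - i))
      (Finset.range_mono (min_le_left j m))
  · rw [List.pairwise_map]
    exact List.pairwise_lt_range.imp fun h => Nat.mul_le_mul_left _ (by omega)

end TopSum

section Transpose

theorem sum_range_card_filter_lt (p : Multiset ℕ) (j : ℕ) :
    ∑ i ∈ Finset.range j, (p.filter fun x => i + 1 ≤ x).card =
      (p.map fun x => min x j).sum := by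
  induction j with
  | zero => simp
  | succ j ih =>
    rw [Finset.sum_range_succ, ih]
    clear ih
    induction p using Multiset.induction_on with
    | empty => simp
    | cons a p ih =>
      by_cases h : j + 1 ≤ a
      · rw [Multiset.filter_cons_of_pos (p := fun x => j + 1 ≤ x) p h, Multiset.card_cons,
          Multiset.map_cons, Multiset.sum_cons, Multiset.map_cons, Multiset.sum_cons]
        omega
      · rw [Multiset.filter_cons_of_neg (p := fun x => j + 1 ≤ x) p h,
          Multiset.map_cons, Multiset.sum_cons, Multiset.map_cons, Multiset.sum_cons]
        omega

theorem sum_map_min_le_topSum_transposeP (p : Multiset ℕ) (j : ℕ) :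
    (p.map fun x => min x j).sum ≤ topSum (transposeP p) j := by
  have hmin : (p.map fun x => min x j) = p.map fun x => min x (min j p.sum) :=
    Multiset.map_congr rfl fun x hx => by
      have := Multiset.le_sum_of_mem hx
      omega
  set f : ℕ → ℕ := fun i => (p.filter fun x => i + 1 ≤ x).card
  have hle : (((Multiset.range (min j p.sum)).map f).filter fun c => c ≠ 0) ≤ transposeP p :=
    Multiset.filter_le_filter _ (Multiset.map_le_map (Multiset.range_le.2 (min_le_right _ _)))
  have hcard : (((Multiset.range (min j p.sum)).map f).filter fun c => c ≠ 0).card ≤ j :=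
    (Multiset.card_le_card (Multiset.filter_le _ _)).trans (by simp)
  refine le_trans (le_of_eq ?_) (sum_le_topSum hle hcard)
  rw [hmin, ← sum_range_card_filter_lt]
  have hfilter (s : Multiset ℕ) : (s.filter fun c => c ≠ 0).sum = s.sum := by
    induction s using Multiset.induction_on with
    | empty => simp
    | cons a s ih => by_cases h : a = 0 <;> simp_all
  rw [hfilter]
  rfl

end Transpose

section Strings

theorem strP_add_two (a : ℕ) : strP (a + 2) = (a + 2) ::ₘ strP a := by
  have h : (a + 2 + 1) / 2 = (a + 1) / 2 + 1 := by omega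
  simp only [strP, h, Multiset.range, Multiset.map_coe, Multiset.cons_coe, List.range_succ_eq_map,
    List.map_cons, List.map_map]
  congr 2
  refine List.map_congr_left fun k _ => ?_
  simp only [Function.comp_apply]
  omega

theorem sum_map_min_strP (a j : ℕ) :
    ((strP a).map fun x => min x j).sum = ∑ i ∈ Finset.range j, (a + 1 - i) / 2 := by
  induction a using Nat.twoStepInduction with
  | zero =>
    rw [Finset.sum_eq_zero fun i _ => by omega]
    simp [strP]
  | one =>
    cases j with
    | zero => simp
    | succ j =>
      rw [Finset.sum_range_succ', Finset.sum_eq_zero fun i _ => by omega]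
      simp [strP]
  | more a ih ih' =>
    rw [strP_add_two, Multiset.map_cons, Multiset.sum_cons, ih]
    clear ih ih'
    induction j with
    | zero => simp
    | succ j ih =>
      rw [Finset.sum_range_succ, Finset.sum_range_succ]
      omega

theorem sum_range_sub_add_sum_range_sub_le (m₁ m₂ a b : ℕ) :
    ∑ i ∈ Finset.range a, (m₁ - i) + ∑ i ∈ Finset.range b, (m₂ - i) ≤
      ∑ i ∈ Finset.range (a + b), (m₁ + m₂ + 1 - i) / 2 +
        ∑ i ∈ Finset.range (a + b), (max m₁ m₂ - min m₁ m₂ - 1 + 1 - i) / 2 := by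
  induction h : a + b generalizing a b with
  | zero =>
    obtain ⟨rfl, rfl⟩ : a = 0 ∧ b = 0 := by omega
    simp
  | succ j ih =>
    rw [Finset.sum_range_succ _ j, Finset.sum_range_succ _ j]
    rcases a with _ | a
    · obtain rfl : b = j + 1 := by omega
      have := ih 0 j (by omega)
      rw [Finset.sum_range_succ]
      omega
    · rcases b with _ | b
      · obtain rfl : a = j := by omega
        have := ih a 0 (by omega)
        rw [Finset.sum_range_succ]
        omega
      · have h₁ := ih a (b + 1) (by omega)
        have h₂ := ih (a + 1) b (by omega)
        rw [Finset.sum_range_succ] at h₁ h₂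
        rw [Finset.sum_range_succ, Finset.sum_range_succ]
        omega

end Strings

theorem topSum_mono (p : Multiset ℕ) {i j : ℕ} (h : i ≤ j) : topSum p i ≤ topSum p j := by
  obtain ⟨s, hs, hc, hsum⟩ := exists_sum_eq_topSum p i
  exact hsum ▸ sum_le_topSum hs (hc.trans h)

/-- combinatorial content of Proposition 4.4(3): the concatenation
over `i = 1, 2` of the iterated sums `∑_P (2m_P⁽ⁱ⁾k_P, …, 4k_P, 2k_P)` is dominated
by the transpose of `⊔_P ([m_P⁽¹⁾+m_P⁽²⁾]^{2k_P} ⊔ [|m_P⁽¹⁾-m_P⁽²⁾|-1]^{2k_P})`. -/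
theorem wavefront_le_dual_unitary_case (n : ℕ) (m₁ m₂ k : Fin n → ℕ)
    (hk : ∀ P, 1 ≤ k P) (hm : ¬ ∀ P, m₁ P = 0 ∧ m₂ P = 0) :
    DomLE
      (((List.finRange n).foldr
          (fun P acc => sumParts ((downP (m₁ P)).map fun x => 2 * k P * x) acc) 0) +
       ((List.finRange n).foldr
          (fun P acc => sumParts ((downP (m₂ P)).map fun x => 2 * k P * x) acc) 0))
      (transposeP (∑ P : Fin n, (2 * k P) •
        (strP (m₁ P + m₂ P) + strP (max (m₁ P) (m₂ P) - min (m₁ P) (m₂ P) - 1)))) := by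
  intro j
  obtain ⟨a, b, hab, hle⟩ := exists_topSum_add_le
    ((List.finRange n).foldr
      (fun P acc => sumParts ((downP (m₁ P)).map fun x => 2 * k P * x) acc) 0)
    ((List.finRange n).foldr
      (fun P acc => sumParts ((downP (m₂ P)).map fun x => 2 * k P * x) acc) 0) j
  have hfold (m : Fin n → ℕ) (c : ℕ) :
      topSum ((List.finRange n).foldr
        (fun P acc => sumParts ((downP (m P)).map fun x => 2 * k P * x) acc) 0) c ≤
      ∑ P, 2 * k P * ∑ i ∈ Finset.range c, (m P - i) := by
    refine (topSum_foldr_sumParts_le _ _ _).trans ?_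
    rw [← List.ofFn_eq_map, List.sum_ofFn]
    exact Finset.sum_le_sum fun P _ => topSum_map_mul_downP_le _ _ _
  refine hle.trans ((add_le_add (hfold m₁ a) (hfold m₂ b)).trans ?_)
  refine le_trans ?_ (topSum_mono _ hab)
  refine le_trans ?_ (sum_map_min_le_topSum_transposeP _ _)
  rw [← Finset.sum_add_distrib, ← Multiset.coe_mapAddMonoidHom, map_sum,
    ← Multiset.coe_sumAddMonoidHom, map_sum]
  refine Finset.sum_le_sum fun P _ => ?_
  rw [map_nsmul, map_nsmul, map_add, map_add, Multiset.coe_mapAddMonoidHom,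
    Multiset.coe_sumAddMonoidHom, sum_map_min_strP, sum_map_min_strP, smul_eq_mul, ← mul_add]
  exact Nat.mul_le_mul_left _ (sum_range_sub_add_sum_range_sub_le _ _ _ _)
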